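/- Let d ≥ 2, let Ω ⊆ ℝ^d be a bounded domain, and let E : Ω → ℝ^d be a bounded C^∞ vector field; set Ω₀ := {x ∈ Ω : |E(x)| > 0}. Let p : Ω → ℝ be continuous with 2d/(d+2) ≤ p⁻ := inf_{x∈Ω} p(x) and p⁺ := sup_{x∈Ω} p(x) < ∞. Let Ω' be an open set whose closure is compact and contained in Ω₀. Then there exists a constant c > 0 such that for every w ∈ C_0^∞(Ω; ℝ^d) (smooth with compact support in Ω) one has ‖w‖_{L^{p(·)}(Ω')} + ‖∇w‖_{L^{p(·)}(Ω')} ≤ c [ (∫_Ω |w|^{p⁻} |E|² dx)^{1/p⁻} + ‖∇w‖_{L^{p(·)}(Ω; |E|²)} ]. -/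

import Mathlib

open MeasureTheory

/-- The weighted Luxemburg norm
`‖f‖_{L^{p(·)}(G;σ)} = inf {λ > 0 | ∫_G (f/λ)^{p(x)} σ(x) dx ≤ 1}` of a
(nonnegative) function `f` over a measurable set `G` with weight `σ`. -/
noncomputable def wLuxNorm (d : ℕ) (G : Set (Fin d → ℝ))
    (p σ f : (Fin d → ℝ) → ℝ) : ℝ :=
  sInf {lam : ℝ | 0 < lam ∧
    (∫⁻ x in G, ENNReal.ofReal ((f x / lam) ^ p x * σ x)) ≤ 1}

open scoped NNReal ENNReal

theorem Real.rpow_le_one_add_rpow {t a b : ℝ} (ht : 0 ≤ t) (ha : 0 ≤ a) (hab : a ≤ b) :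
    t ^ a ≤ 1 + t ^ b := by
  rcases le_total t 1 with h | h
  · exact (Real.rpow_le_one ht h ha).trans (le_add_of_nonneg_right (Real.rpow_nonneg ht b))
  · exact (Real.rpow_le_rpow_of_exponent_le h hab).trans (le_add_of_nonneg_left zero_le_one)

section Modular

variable {X : Type*} [MeasurableSpace X] {μ : Measure X} {s : Set X}

theorem setLIntegral_rpow_le_measure_add {t a b : X → ℝ} (hs : MeasurableSet s)
    (ht : ∀ x ∈ s, 0 ≤ t x) (ha : ∀ x ∈ s, 0 ≤ a x) (hab : ∀ x ∈ s, a x ≤ b x) :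
    ∫⁻ x in s, ENNReal.ofReal (t x ^ a x) ∂μ ≤
      μ s + ∫⁻ x in s, ENNReal.ofReal (t x ^ b x) ∂μ := by
  calc ∫⁻ x in s, ENNReal.ofReal (t x ^ a x) ∂μ
      ≤ ∫⁻ x in s, (1 + ENNReal.ofReal (t x ^ b x)) ∂μ := by
        refine setLIntegral_mono' hs fun x hx => ?_
        rw [← ENNReal.ofReal_one, ← ENNReal.ofReal_add zero_le_one
          (Real.rpow_nonneg (ht x hx) _)]
        exact ENNReal.ofReal_le_ofReal
          (Real.rpow_le_one_add_rpow (ht x hx) (ha x hx) (hab x hx))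
    _ = μ s + ∫⁻ x in s, ENNReal.ofReal (t x ^ b x) ∂μ := by
        rw [lintegral_add_left measurable_const, setLIntegral_one]

theorem setLIntegral_le_of_weight_ge {U : Set X} {g σ : X → ℝ} {δ : ℝ} {K : ℝ≥0∞}
    (hs : MeasurableSet s) (hsU : s ⊆ U) (hδ : 0 < δ) (hg : ∀ x ∈ s, 0 ≤ g x)
    (hσ : ∀ x ∈ s, δ ≤ σ x) (hK : ∫⁻ x in U, ENNReal.ofReal (g x * σ x) ∂μ ≤ K) :
    ∫⁻ x in s, ENNReal.ofReal (g x) ∂μ ≤ ENNReal.ofReal δ⁻¹ * K := by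
  calc ∫⁻ x in s, ENNReal.ofReal (g x) ∂μ
      ≤ ∫⁻ x in s, ENNReal.ofReal δ⁻¹ * ENNReal.ofReal (g x * σ x) ∂μ := by
        refine setLIntegral_mono' hs fun x hx => ?_
        rw [← ENNReal.ofReal_mul (inv_nonneg.2 hδ.le)]
        refine ENNReal.ofReal_le_ofReal ?_
        rw [inv_mul_eq_div, le_div_iff₀ hδ]
        exact mul_le_mul_of_nonneg_left (hσ x hx) (hg x hx)
    _ = ENNReal.ofReal δ⁻¹ * ∫⁻ x in s, ENNReal.ofReal (g x * σ x) ∂μ :=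
        lintegral_const_mul' _ _ ENNReal.ofReal_ne_top
    _ ≤ ENNReal.ofReal δ⁻¹ * K := by
        gcongr
        exact (lintegral_mono_set hsU).trans hK

theorem lintegral_ofReal_norm_rpow_eq_eLpNorm_rpow {G : Type*} [NormedAddCommGroup G]
    (f : X → G) {q : ℝ≥0} (hq : q ≠ 0) :
    ∫⁻ x, ENNReal.ofReal (‖f x‖ ^ (q : ℝ)) ∂μ = eLpNorm f q μ ^ (q : ℝ) := by
  rw [eLpNorm_nnreal_pow_eq_lintegral hq]
  refine lintegral_congr fun x => ?_
  rw [← ENNReal.ofReal_rpow_of_nonneg (norm_nonneg _) q.coe_nonneg, ofReal_norm]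

theorem eLpNorm_le_of_lintegral_le {G : Type*} [NormedAddCommGroup G]
    {f : X → G} {q : ℝ≥0} (hq : q ≠ 0) {K : ℝ≥0∞}
    (hK : ∫⁻ x, ENNReal.ofReal (‖f x‖ ^ (q : ℝ)) ∂μ ≤ K) :
    eLpNorm f q μ ≤ K ^ (q : ℝ)⁻¹ := by
  rw [lintegral_ofReal_norm_rpow_eq_eLpNorm_rpow f hq] at hK
  exact (ENNReal.le_rpow_inv_iff (by positivity)).2 hK

end Modular


theorem exists_sobolev_exponent {n : ℕ} (hn : 2 ≤ n) {s q : ℝ≥0} (hs : 1 ≤ s) (hq : 1 ≤ q)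
    (hqs : (q : ℝ) ≤ s + (n : ℝ)⁻¹) :
    ∃ r : ℝ≥0, 1 ≤ r ∧ r ≤ s ∧ r < n ∧ (r : ℝ)⁻¹ - (n : ℝ)⁻¹ ≤ (q : ℝ)⁻¹ := by
  have hn' : (2 : ℝ) ≤ n := by exact_mod_cast hn
  have hs' : (1 : ℝ) ≤ s := by exact_mod_cast hs
  have hq' : (1 : ℝ) ≤ q := by exact_mod_cast hq
  by_cases hsn : s < n ∧ (s : ℝ)⁻¹ - (n : ℝ)⁻¹ ≤ (q : ℝ)⁻¹
  · exact ⟨s, hs, le_rfl, hsn.1, hsn.2⟩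
  have hns : (n : ℝ) ≤ s := by
    by_contra! h
    refine hsn ⟨by exact_mod_cast h, ?_⟩
    rcases le_total (q : ℝ) s with hle | hle
    · have : 0 ≤ (n : ℝ)⁻¹ := by positivity
      have : (s : ℝ)⁻¹ ≤ (q : ℝ)⁻¹ := by gcongr
      linarith
    · have : (s : ℝ)⁻¹ - (q : ℝ)⁻¹ = (q - s) / (s * q) := by field_simp
      have : (q - s) / (s * q) ≤ (q - s : ℝ) :=
        div_le_self (by linarith) (by nlinarith)
      linarith
  let m : ℝ≥0 := max q 2
  have hm2 : (2 : ℝ) ≤ m := by exact_mod_cast le_max_right q 2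
  have hqm : (q : ℝ) ≤ m := by exact_mod_cast le_max_left q 2
  have hnn : (0 : ℝ≥0) < n := by exact_mod_cast (by linarith : 0 < n)
  have hr : ((((n : ℝ≥0)⁻¹ + m⁻¹)⁻¹ : ℝ≥0) : ℝ) = ((n : ℝ)⁻¹ + (m : ℝ)⁻¹)⁻¹ := by push_cast; rfl
  have hminv : 0 < (m : ℝ)⁻¹ := by positivity
  have hlt : ((n : ℝ)⁻¹ + (m : ℝ)⁻¹)⁻¹ < n :=
    inv_lt_of_inv_lt₀ (by linarith) (by linarith)
  refine ⟨((n : ℝ≥0)⁻¹ + m⁻¹)⁻¹, ?_, ?_, ?_, ?_⟩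
  · rw [← NNReal.coe_le_coe, hr, NNReal.coe_one]
    refine (one_le_inv₀ (by positivity)).2 ?_
    have h1 : (n : ℝ)⁻¹ ≤ 2⁻¹ := by gcongr
    have h2 : (m : ℝ)⁻¹ ≤ 2⁻¹ := by gcongr
    linarith
  · rw [← NNReal.coe_le_coe, hr]
    linarith
  · rw [← NNReal.coe_lt_coe, hr]
    exact_mod_cast hlt
  · rw [hr, inv_inv, add_sub_cancel_left]
    gcongr

section LocalSobolev

variable {X F : Type*} [NormedAddCommGroup X] [NormedSpace ℝ X] [FiniteDimensional ℝ X]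
  [MeasurableSpace X] [BorelSpace X] [NormedAddCommGroup F] [NormedSpace ℝ F]
  [FiniteDimensional ℝ F] (μ : Measure X) [μ.IsAddHaarMeasure]

theorem exists_eLpNorm_closedBall_le_of_exponent_le (x : X) (ρ : ℝ) {a b : ℝ≥0}
    (hab : a ≤ b) (ha : 0 < a) (G : Type*) [NormedAddCommGroup G] [SecondCountableTopology G] :
    ∃ C : ℝ≥0∞, C ≠ ⊤ ∧ ∀ u : X → G, Continuous u →
      eLpNorm u a (μ.restrict (Metric.closedBall x ρ)) ≤
        C * eLpNorm u b (μ.restrict (Metric.closedBall x ρ)) := by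
  refine ⟨μ.restrict (Metric.closedBall x ρ) Set.univ ^ (1 / (a : ℝ) - 1 / (b : ℝ)), ?_, ?_⟩
  · refine ENNReal.rpow_ne_top_of_nonneg ?_ ?_
    · have : (a : ℝ) ≤ b := by exact_mod_cast hab
      have ha' : (0 : ℝ) < a := by exact_mod_cast ha
      exact sub_nonneg.2 (one_div_le_one_div_of_le ha' this)
    · rw [Measure.restrict_apply_univ]
      exact (isCompact_closedBall x ρ).measure_lt_top.ne
  · intro u hu
    rw [mul_comm]
    exact eLpNorm_le_eLpNorm_mul_rpow_measure_univ (by exact_mod_cast hab)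
      hu.aestronglyMeasurable

theorem exists_eLpNorm_closedBall_le_of_le_add_inv (hX : 2 ≤ Module.finrank ℝ X) (x : X)
    {ρ₁ ρ₂ : ℝ} (hρ₁ : 0 < ρ₁) (hρ : ρ₁ < ρ₂) {s q : ℝ≥0} (hs : 1 ≤ s) (hq : 1 ≤ q)
    (hqs : (q : ℝ) ≤ s + (Module.finrank ℝ X : ℝ)⁻¹) :
    ∃ C : ℝ≥0∞, C ≠ ⊤ ∧ ∀ u : X → F, ContDiff ℝ 1 u →
      eLpNorm u q (μ.restrict (Metric.closedBall x ρ₁)) ≤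
        C * (eLpNorm u s (μ.restrict (Metric.closedBall x ρ₂)) +
          eLpNorm (fderiv ℝ u) s (μ.restrict (Metric.closedBall x ρ₂))) := by
  obtain ⟨r, hr1, hrs, hrn, hrq⟩ := exists_sobolev_exponent hX hs hq hqs
  have hr0 : 0 < r := lt_of_lt_of_le one_pos hr1
  obtain ⟨C₁, hC₁, hu₁⟩ := exists_eLpNorm_closedBall_le_of_exponent_le μ x ρ₂ hrs hr0 F
  obtain ⟨C₂, hC₂, hu₂⟩ := exists_eLpNorm_closedBall_le_of_exponent_le μ x ρ₂ hrs hr0 (X →L[ℝ] F)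
  let η : ContDiffBump x := ⟨ρ₁, ρ₂, hρ₁, hρ⟩
  have hη : ContDiff ℝ 1 η := η.contDiff
  obtain ⟨D, hD⟩ := (η.hasCompactSupport.fderiv (𝕜 := ℝ)).exists_bound_of_continuous
    (hη.continuous_fderiv one_ne_zero)
  let S := eLpNormLESNormFDerivOfLeConst F μ (Metric.closedBall x ρ₂) r q
  refine ⟨S * (C₂ + ‖D‖ₑ * C₁), by finiteness, fun u hu => ?_⟩
  have hsm : ContDiff ℝ 1 (fun y => η y • u y) := hη.smul hu
  have htsupp : tsupport (fun y => η y • u y) ⊆ Metric.closedBall x ρ₂ :=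
    (tsupport_smul_subset_left _ _).trans η.tsupport_eq.subset
  have hfd : Continuous (fderiv ℝ u) := hu.continuous_fderiv one_ne_zero
  calc eLpNorm u q (μ.restrict (Metric.closedBall x ρ₁))
      = eLpNorm (fun y => η y • u y) q (μ.restrict (Metric.closedBall x ρ₁)) := by
        refine eLpNorm_congr_ae ?_
        filter_upwards [ae_restrict_mem Metric.isClosed_closedBall.measurableSet] with y hy
        rw [η.one_of_mem_closedBall hy, one_smul]
    _ ≤ eLpNorm (fun y => η y • u y) q μ := eLpNorm_mono_measure _ Measure.restrict_le_self
    _ ≤ S * eLpNorm (fderiv ℝ fun y => η y • u y) r μ :=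
        eLpNorm_le_eLpNorm_fderiv_of_le μ hsm ((subset_tsupport _).trans htsupp) hr1
          (by exact_mod_cast hrn) (by exact_mod_cast hrq) Metric.isBounded_closedBall
    _ = S * eLpNorm (fderiv ℝ fun y => η y • u y) r (μ.restrict (Metric.closedBall x ρ₂)) := by
        rw [← eLpNorm_restrict_eq_of_support_subset (f := fderiv ℝ fun y => η y • u y)
          ((support_fderiv_subset ℝ).trans htsupp)]
    _ ≤ S * eLpNorm ((fun y => ‖fderiv ℝ u y‖) + D • fun y => ‖u y‖) r
          (μ.restrict (Metric.closedBall x ρ₂)) := by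
        gcongr
        refine eLpNorm_mono_real fun y => ?_
        rw [fderiv_fun_smul (hη.differentiable one_ne_zero y) (hu.differentiable one_ne_zero y)]
        refine (norm_add_le _ _).trans (add_le_add ?_ ?_)
        · rw [norm_smul, Real.norm_of_nonneg η.nonneg]
          exact mul_le_of_le_one_left (norm_nonneg _) η.le_one
        · rw [ContinuousLinearMap.norm_smulRight_apply]
          exact mul_le_mul_of_nonneg_right (hD y) (norm_nonneg _)
    _ ≤ S * (eLpNorm (fderiv ℝ u) r (μ.restrict (Metric.closedBall x ρ₂)) +
          ‖D‖ₑ * eLpNorm u r (μ.restrict (Metric.closedBall x ρ₂))) := by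
        gcongr
        refine (eLpNorm_add_le hfd.norm.aestronglyMeasurable
          (hu.continuous.norm.const_smul D).aestronglyMeasurable (by exact_mod_cast hr1)).trans ?_
        rw [eLpNorm_const_smul, eLpNorm_norm, eLpNorm_norm]
    _ ≤ S * (C₂ * eLpNorm (fderiv ℝ u) s (μ.restrict (Metric.closedBall x ρ₂)) +
          ‖D‖ₑ * (C₁ * eLpNorm u s (μ.restrict (Metric.closedBall x ρ₂)))) := by
        gcongr
        · exact hu₂ _ hfd
        · exact hu₁ _ hu.continuous
    _ ≤ S * (C₂ + ‖D‖ₑ * C₁) * (eLpNorm u s (μ.restrict (Metric.closedBall x ρ₂)) +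
          eLpNorm (fderiv ℝ u) s (μ.restrict (Metric.closedBall x ρ₂))) := by
        rw [mul_assoc]
        gcongr
        rw [add_mul, ← mul_assoc]
        gcongr
        · exact le_add_self
        · exact le_self_add

theorem exists_eLpNorm_closedBall_le (hX : 2 ≤ Module.finrank ℝ X) (x : X)
    {a r : ℝ≥0} (ha : 1 ≤ a) (hr : 1 ≤ r) {ρ₁ ρ₂ : ℝ} (hρ₁ : 0 < ρ₁) (hρ : ρ₁ < ρ₂)
    {q : ℝ≥0} (hq : 1 ≤ q) (hqr : (q : ℝ) ≤ r + (Module.finrank ℝ X : ℝ)⁻¹) :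
    ∃ C : ℝ≥0∞, C ≠ ⊤ ∧ ∀ u : X → F, ContDiff ℝ 1 u →
      eLpNorm u q (μ.restrict (Metric.closedBall x ρ₁)) ≤
        C * (eLpNorm u a (μ.restrict (Metric.closedBall x ρ₂)) +
          eLpNorm (fderiv ℝ u) r (μ.restrict (Metric.closedBall x ρ₂))) := by
  have hn : (0 : ℝ) < (Module.finrank ℝ X : ℝ)⁻¹ := by
    have : 0 < Module.finrank ℝ X := by lia
    positivity
  obtain ⟨k, hk⟩ : ∃ k : ℕ, (q : ℝ) ≤ a + k * (Module.finrank ℝ X : ℝ)⁻¹ := by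
    obtain ⟨k, hk⟩ := exists_nat_ge ((q : ℝ) / (Module.finrank ℝ X : ℝ)⁻¹)
    rw [div_le_iff₀ hn] at hk
    exact ⟨k, hk.trans (le_add_of_nonneg_left a.coe_nonneg)⟩
  induction k generalizing ρ₁ q with
  | zero =>
    have hqa : q ≤ a := by exact_mod_cast (by simpa using hk : (q : ℝ) ≤ a)
    obtain ⟨C, hC, h⟩ := exists_eLpNorm_closedBall_le_of_exponent_le μ x ρ₂ hqa
      (one_pos.trans_le hq) F
    refine ⟨C, hC, fun u hu => ?_⟩
    calc _ ≤ eLpNorm u q (μ.restrict (Metric.closedBall x ρ₂)) :=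
          eLpNorm_mono_measure _
            (Measure.restrict_mono (Metric.closedBall_subset_closedBall hρ.le) le_rfl)
      _ ≤ _ := h u hu.continuous
      _ ≤ _ := by gcongr; exact le_self_add
  | succ k ih =>
    have ha' : (1 : ℝ) ≤ a := by exact_mod_cast ha
    have hr' : (1 : ℝ) ≤ r := by exact_mod_cast hr
    push_cast at hk
    let s : ℝ≥0 := (max 1 ((q : ℝ) - (Module.finrank ℝ X : ℝ)⁻¹)).toNNReal
    have hs : (s : ℝ) = max 1 ((q : ℝ) - (Module.finrank ℝ X : ℝ)⁻¹) :=
      Real.coe_toNNReal _ (zero_le_one.trans (le_max_left _ _))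
    have hs1 : 1 ≤ s := by
      rw [← NNReal.coe_le_coe, hs]
      exact le_max_left _ _
    have hsr : (s : ℝ) ≤ r := hs.trans_le (max_le hr' (by linarith))
    have hqs : (q : ℝ) ≤ s + (Module.finrank ℝ X : ℝ)⁻¹ := by
      have := le_max_right 1 ((q : ℝ) - (Module.finrank ℝ X : ℝ)⁻¹)
      linarith
    have hsk : (s : ℝ) ≤ a + k * (Module.finrank ℝ X : ℝ)⁻¹ := by
      rw [hs]
      refine max_le ?_ (by linarith)
      have : 0 ≤ k * (Module.finrank ℝ X : ℝ)⁻¹ := by positivity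
      linarith
    obtain ⟨ρ, h1, h2⟩ := exists_between hρ
    obtain ⟨C₁, hC₁, hstep⟩ := exists_eLpNorm_closedBall_le_of_le_add_inv (F := F) μ hX x hρ₁ h1
      hs1 hq hqs
    obtain ⟨C₂, hC₂, hind⟩ := ih (hρ₁.trans h1) h2 hs1 (by linarith) hsk
    obtain ⟨C₃, hC₃, hexp⟩ := exists_eLpNorm_closedBall_le_of_exponent_le μ x ρ
      (show s ≤ r by exact_mod_cast hsr) (one_pos.trans_le hs1) (X →L[ℝ] F)
    refine ⟨C₁ * (C₂ + C₃), by finiteness, fun u hu => (hstep u hu).trans ?_⟩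
    rw [mul_assoc]
    gcongr
    rw [add_mul]
    refine add_le_add (hind u hu) ((hexp _ (hu.continuous_fderiv one_ne_zero)).trans ?_)
    gcongr
    refine (eLpNorm_mono_measure _
      (Measure.restrict_mono (Metric.closedBall_subset_closedBall h2.le) le_rfl)).trans ?_
    exact le_add_self

theorem exists_nhds_modular_le (hX : 2 ≤ Module.finrank ℝ X) {U : Set X} {x : X} (hU : U ∈ nhds x)
    {p σ : X → ℝ} (hp : ContinuousAt p x) (hσ : ContinuousAt σ x) (hσx : 0 < σ x)
    {a : ℝ} (ha : 1 ≤ a) (hp1 : ∀ y ∈ U, 1 ≤ p y) :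
    ∃ t ∈ nhds x, ∃ K : ℝ≥0∞, K ≠ ⊤ ∧ ∀ v : X → F, ContDiff ℝ 1 v →
      ∫⁻ y in U, ENNReal.ofReal (‖v y‖ ^ a * σ y) ∂μ ≤ 1 →
      ∫⁻ y in U, ENNReal.ofReal (‖fderiv ℝ v y‖ ^ p y * σ y) ∂μ ≤ 1 →
      ∫⁻ y in t, ENNReal.ofReal (‖v y‖ ^ p y) ∂μ ≤ K := by
  have hn : (0 : ℝ) < (Module.finrank ℝ X : ℝ)⁻¹ := by
    have : 0 < Module.finrank ℝ X := by lia
    positivity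
  set ε : ℝ := (Module.finrank ℝ X : ℝ)⁻¹ / 2 with hε
  have hpx : 1 ≤ p x := hp1 x (mem_of_mem_nhds hU)
  have hev : ∀ᶠ y in nhds x, y ∈ U ∧ p x - ε < p y ∧ p y < p x + ε ∧ σ x / 2 < σ y :=
    Filter.Eventually.and hU <| (hp.eventually_const_lt (by linarith)).and <|
      (hp.eventually_lt_const (by linarith)).and (hσ.eventually_const_lt (by linarith))
  obtain ⟨ρ, hρ, hball⟩ := Metric.nhds_basis_closedBall.eventually_iff.1 hev
  set B := Metric.closedBall x ρ
  have hB : MeasurableSet B := Metric.isClosed_closedBall.measurableSet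
  have hBfin : μ B ≠ ⊤ := (isCompact_closedBall x ρ).measure_lt_top.ne
  have hBU : B ⊆ U := fun y hy => (hball hy).1
  lift a to ℝ≥0 using zero_le_one.trans ha
  obtain ⟨r, hr⟩ : ∃ r : ℝ≥0, (r : ℝ) = max 1 (p x - ε) :=
    ⟨⟨_, zero_le_one.trans (le_max_left _ _)⟩, rfl⟩
  obtain ⟨q, hq⟩ : ∃ q : ℝ≥0, (q : ℝ) = p x + ε := ⟨⟨p x + ε, by linarith⟩, rfl⟩
  have hr1 : 1 ≤ r := by
    rw [← NNReal.coe_le_coe, hr]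
    exact le_max_left _ _
  have hq1 : 1 ≤ q := by
    rw [← NNReal.coe_le_coe, hq, NNReal.coe_one]
    linarith
  have hqr : (q : ℝ) ≤ r + (Module.finrank ℝ X : ℝ)⁻¹ := by
    have := le_max_right 1 (p x - ε)
    linarith
  have hrp : ∀ y ∈ B, (r : ℝ) ≤ p y := fun y hy =>
    hr.trans_le (max_le (hp1 y (hBU hy)) (hball hy).2.1.le)
  have ha1 : 1 ≤ a := by exact_mod_cast ha
  have ha0 : a ≠ 0 := (one_pos.trans_le ha1).ne'
  have hr0 : r ≠ 0 := (one_pos.trans_le hr1).ne'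
  have hq0 : q ≠ 0 := (one_pos.trans_le hq1).ne'
  obtain ⟨C, hC, hsob⟩ := exists_eLpNorm_closedBall_le (F := F) μ hX x ha1 hr1
    (half_pos hρ) (half_lt_self hρ) hq1 hqr
  set b := Metric.closedBall x (ρ / 2)
  have hb : MeasurableSet b := Metric.isClosed_closedBall.measurableSet
  have hbB : b ⊆ B := Metric.closedBall_subset_closedBall (half_le_self hρ.le)
  set k : ℝ≥0∞ := ENNReal.ofReal (σ x / 2)⁻¹ * 1
  have hk : k ≠ ⊤ := by finiteness
  refine ⟨b, Metric.closedBall_mem_nhds x (half_pos hρ),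
    μ B + (C * (k ^ (a : ℝ)⁻¹ + (μ B + k) ^ (r : ℝ)⁻¹)) ^ (q : ℝ), ?_, fun v hv hv0 hv1 => ?_⟩
  · have h1 : k ^ (a : ℝ)⁻¹ ≠ ⊤ := ENNReal.rpow_ne_top_of_nonneg (by positivity) hk
    have h2 : (μ B + k) ^ (r : ℝ)⁻¹ ≠ ⊤ :=
      ENNReal.rpow_ne_top_of_nonneg (by positivity) (by finiteness)
    have h3 : (C * (k ^ (a : ℝ)⁻¹ + (μ B + k) ^ (r : ℝ)⁻¹)) ^ (q : ℝ) ≠ ⊤ :=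
      ENNReal.rpow_ne_top_of_nonneg q.coe_nonneg (by finiteness)
    finiteness
  have hσB : ∀ y ∈ B, σ x / 2 ≤ σ y := fun y hy => (hball hy).2.2.2.le
  have hva : eLpNorm v a (μ.restrict B) ≤ k ^ (a : ℝ)⁻¹ :=
    eLpNorm_le_of_lintegral_le ha0 (setLIntegral_le_of_weight_ge hB hBU (half_pos hσx)
      (fun y _ => by positivity) hσB hv0)
  have hvr : eLpNorm (fderiv ℝ v) r (μ.restrict B) ≤ (μ B + k) ^ (r : ℝ)⁻¹ := by
    refine eLpNorm_le_of_lintegral_le hr0 ((setLIntegral_rpow_le_measure_add hB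
      (fun y _ => norm_nonneg _) (fun y _ => r.coe_nonneg) hrp).trans ?_)
    gcongr
    exact setLIntegral_le_of_weight_ge hB hBU (half_pos hσx)
      (fun y _ => by positivity) hσB hv1
  calc ∫⁻ y in b, ENNReal.ofReal (‖v y‖ ^ p y) ∂μ
      ≤ μ b + ∫⁻ y in b, ENNReal.ofReal (‖v y‖ ^ (q : ℝ)) ∂μ :=
        setLIntegral_rpow_le_measure_add hb (fun y _ => norm_nonneg _)
          (fun y hy => zero_le_one.trans (hp1 y (hBU (hbB hy))))
          (fun y hy => hq ▸ (hball (hbB hy)).2.2.1.le)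
    _ = μ b + eLpNorm v q (μ.restrict b) ^ (q : ℝ) := by
        rw [lintegral_ofReal_norm_rpow_eq_eLpNorm_rpow v hq0]
    _ ≤ μ B + (C * (k ^ (a : ℝ)⁻¹ + (μ B + k) ^ (r : ℝ)⁻¹)) ^ (q : ℝ) := by
        gcongr
        exact (hsob v hv).trans (by gcongr)

theorem exists_modular_le_of_isCompact (hX : 2 ≤ Module.finrank ℝ X) {U Q : Set X}
    (hU : IsOpen U) (hQ : IsCompact Q) (hQU : Q ⊆ U)
    {p σ : X → ℝ} (hp : ContinuousOn p U) (hσ : ContinuousOn σ U) (hσQ : ∀ y ∈ Q, 0 < σ y)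
    {a : ℝ} (ha : 1 ≤ a) (hp1 : ∀ y ∈ U, 1 ≤ p y) :
    ∃ K : ℝ≥0∞, K ≠ ⊤ ∧ ∀ v : X → F, ContDiff ℝ 1 v →
      ∫⁻ y in U, ENNReal.ofReal (‖v y‖ ^ a * σ y) ∂μ ≤ 1 →
      ∫⁻ y in U, ENNReal.ofReal (‖fderiv ℝ v y‖ ^ p y * σ y) ∂μ ≤ 1 →
      ∫⁻ y in Q, ENNReal.ofReal (‖v y‖ ^ p y) ∂μ ≤ K := by
  refine hQ.induction_on (p := fun t => ∃ K : ℝ≥0∞, K ≠ ⊤ ∧ ∀ v : X → F, ContDiff ℝ 1 v →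
      ∫⁻ y in U, ENNReal.ofReal (‖v y‖ ^ a * σ y) ∂μ ≤ 1 →
      ∫⁻ y in U, ENNReal.ofReal (‖fderiv ℝ v y‖ ^ p y * σ y) ∂μ ≤ 1 →
      ∫⁻ y in t, ENNReal.ofReal (‖v y‖ ^ p y) ∂μ ≤ K) ?_ ?_ ?_ ?_
  · exact ⟨0, by simp, by simp⟩
  · rintro s t hst ⟨K, hK, h⟩
    exact ⟨K, hK, fun v hv h0 h1 => (lintegral_mono_set hst).trans (h v hv h0 h1)⟩
  · rintro s t ⟨K, hK, h⟩ ⟨L, hL, h'⟩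
    exact ⟨K + L, by finiteness, fun v hv h0 h1 =>
      (lintegral_union_le _ s t).trans (add_le_add (h v hv h0 h1) (h' v hv h0 h1))⟩
  · intro x hx
    have hUx : U ∈ nhds x := hU.mem_nhds (hQU hx)
    obtain ⟨t, ht, h⟩ := exists_nhds_modular_le (F := F) μ hX hUx (hp.continuousAt hUx)
      (hσ.continuousAt hUx) (hσQ x hx) ha hp1
    exact ⟨t, mem_nhdsWithin_of_mem_nhds ht, h⟩

end LocalSobolev

section Luxemburg

variable {d : ℕ} {G : Set (Fin d → ℝ)} {p σ f : (Fin d → ℝ) → ℝ}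

theorem wLuxNorm_le {lam : ℝ} (hlam : 0 < lam)
    (h : ∫⁻ x in G, ENNReal.ofReal ((f x / lam) ^ p x * σ x) ≤ 1) : wLuxNorm d G p σ f ≤ lam :=
  csInf_le ⟨0, fun _ hx => hx.1.le⟩ ⟨hlam, h⟩

theorem wLuxNorm_one_le_mul (hG : MeasurableSet G) (hp : ∀ x ∈ G, 1 ≤ p x)
    (hf : ∀ x, 0 ≤ f x) {K lam : ℝ} (hK : 1 ≤ K) (hlam : 0 < lam)
    (h : ∫⁻ x in G, ENNReal.ofReal ((f x / lam) ^ p x) ≤ ENNReal.ofReal K) :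
    wLuxNorm d G p (fun _ => 1) f ≤ K * lam := by
  have hK0 : 0 < K := one_pos.trans_le hK
  refine wLuxNorm_le (by positivity) ?_
  calc ∫⁻ x in G, ENNReal.ofReal ((f x / (K * lam)) ^ p x * 1)
      ≤ ∫⁻ x in G, ENNReal.ofReal K⁻¹ * ENNReal.ofReal ((f x / lam) ^ p x) := by
        refine setLIntegral_mono' hG fun x hx => ?_
        rw [← ENNReal.ofReal_mul (by positivity), mul_one]
        refine ENNReal.ofReal_le_ofReal ?_
        have hfl : 0 ≤ f x / lam := div_nonneg (hf x) hlam.le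
        rw [show f x / (K * lam) = K⁻¹ * (f x / lam) by field_simp,
          Real.mul_rpow (by positivity) hfl]
        refine mul_le_mul_of_nonneg_right ?_ (Real.rpow_nonneg hfl _)
        exact Real.rpow_le_self_of_le_one (by positivity) (inv_le_one_of_one_le₀ hK) (hp x hx)
    _ = ENNReal.ofReal K⁻¹ * ∫⁻ x in G, ENNReal.ofReal ((f x / lam) ^ p x) :=
        lintegral_const_mul' _ _ ENNReal.ofReal_ne_top
    _ ≤ ENNReal.ofReal K⁻¹ * ENNReal.ofReal K := by gcongr
    _ = 1 := by
        rw [← ENNReal.ofReal_mul (by positivity), inv_mul_cancel₀ hK0.ne', ENNReal.ofReal_one]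

theorem setLIntegral_ofReal_le_mul_measureReal {g : (Fin d → ℝ) → ℝ} (hG : MeasurableSet G)
    (hGfin : volume G ≠ ⊤) {c : ℝ} (hc : 0 ≤ c) (hg : ∀ x ∈ G, g x ≤ c) :
    ∫⁻ x in G, ENNReal.ofReal (g x) ≤ ENNReal.ofReal (c * volume.real G) := by
  calc ∫⁻ x in G, ENNReal.ofReal (g x) ≤ ∫⁻ x in G, ENNReal.ofReal c :=
        setLIntegral_mono' hG fun x hx => ENNReal.ofReal_le_ofReal (hg x hx)
    _ = ENNReal.ofReal (c * volume.real G) := by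
        rw [setLIntegral_const, ENNReal.ofReal_mul hc, ofReal_measureReal hGfin]

theorem exists_pos_modular_div_le_one (hG : MeasurableSet G) (hGfin : volume G ≠ ⊤)
    (hp : ∀ x ∈ G, 1 ≤ p x) {S B : ℝ} (hσ : ∀ x ∈ G, 0 ≤ σ x ∧ σ x ≤ S) (hS : 0 ≤ S)
    (hf : ∀ x, 0 ≤ f x ∧ f x ≤ B) :
    ∃ lam : ℝ, 0 < lam ∧ ∫⁻ x in G, ENNReal.ofReal ((f x / lam) ^ p x * σ x) ≤ 1 := by
  have hB : 0 ≤ B := (hf 0).1.trans (hf 0).2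
  have hV : 0 ≤ S * volume.real G := mul_nonneg hS measureReal_nonneg
  obtain ⟨k, hk⟩ : ∃ k : ℝ, k = 1 + S * volume.real G := ⟨_, rfl⟩
  have hk1 : 1 ≤ k := by linarith
  have hk0 : 0 < k := by linarith
  refine ⟨(B + 1) * k, by positivity, ?_⟩
  refine (setLIntegral_ofReal_le_mul_measureReal hG hGfin (c := k⁻¹ * S) (by positivity)
    fun x hx => ?_).trans ?_
  · have h0 : 0 ≤ f x / ((B + 1) * k) := div_nonneg (hf x).1 (by positivity)
    have h1 : f x / ((B + 1) * k) ≤ k⁻¹ := by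
      rw [div_le_iff₀ (by positivity), show k⁻¹ * ((B + 1) * k) = B + 1 by field_simp]
      linarith [(hf x).2]
    refine mul_le_mul ?_ (hσ x hx).2 (hσ x hx).1 (by positivity)
    exact (Real.rpow_le_self_of_le_one h0 (h1.trans (inv_le_one_of_one_le₀ hk1)) (hp x hx)).trans h1
  · rw [ENNReal.ofReal_le_one, mul_assoc, inv_mul_le_one₀ hk0]
    linarith

end Luxemburg

theorem lintegral_div_rpow_mul_le_one {X : Type*} [MeasurableSpace X] {μ : Measure X}
    {f σ : X → ℝ} (hf : ∀ x, 0 ≤ f x) {a Λ : ℝ} (ha : 0 < a) (hΛ : 0 < Λ)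
    (hfin : ∫⁻ x, ENNReal.ofReal (f x ^ a * σ x) ∂μ ≠ ⊤)
    (h : (∫⁻ x, ENNReal.ofReal (f x ^ a * σ x) ∂μ).toReal ^ (1 / a) ≤ Λ) :
    ∫⁻ x, ENNReal.ofReal ((f x / Λ) ^ a * σ x) ∂μ ≤ 1 := by
  have hΛa : 0 < Λ ^ a := Real.rpow_pos_of_pos hΛ a
  calc ∫⁻ x, ENNReal.ofReal ((f x / Λ) ^ a * σ x) ∂μ
      = ∫⁻ x, ENNReal.ofReal (Λ ^ a)⁻¹ * ENNReal.ofReal (f x ^ a * σ x) ∂μ := by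
        refine lintegral_congr fun x => ?_
        rw [← ENNReal.ofReal_mul (by positivity), Real.div_rpow (hf x) hΛ.le]
        congr 1
        ring
    _ = ENNReal.ofReal (Λ ^ a)⁻¹ * ∫⁻ x, ENNReal.ofReal (f x ^ a * σ x) ∂μ :=
        lintegral_const_mul' _ _ ENNReal.ofReal_ne_top
    _ ≤ 1 := by
        rw [← ENNReal.ofReal_toReal hfin, ← ENNReal.ofReal_mul (by positivity),
          ENNReal.ofReal_le_one, inv_mul_le_one₀ hΛa]
        rwa [one_div, Real.rpow_inv_le_iff_of_pos ENNReal.toReal_nonneg hΛ.le ha] at h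

/-- estimate (4.10) of the paper, underlying Lemma 4.7:
the local `W^{1,p(·)}` bound for compactly supported smooth vector fields by
the weighted `X̊_∇^{p⁻,p(·)}(Ω;|E|²)`-norm, on `Ω' ⊂⊂ Ω₀`. -/
theorem weighted_local_W1p_estimate
    (d : ℕ) (hd : 2 ≤ d) (Ω : Set (Fin d → ℝ))
    (hΩo : IsOpen Ω) (hΩconn : IsConnected Ω) (hΩb : Bornology.IsBounded Ω)
    (E : (Fin d → ℝ) → (Fin d → ℝ)) (hEc : ContDiffOn ℝ (⊤ : ℕ∞) E Ω)
    (M : ℝ) (hEb : ∀ x ∈ Ω, ‖E x‖ ≤ M)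
    (p : (Fin d → ℝ) → ℝ) (hpc : ContinuousOn p Ω)
    (pminus pplus : ℝ) (hpm : 2 * (d : ℝ) / ((d : ℝ) + 2) ≤ pminus)
    (hbounds : ∀ x ∈ Ω, pminus ≤ p x ∧ p x ≤ pplus)
    (Ω' : Set (Fin d → ℝ)) (hΩ'o : IsOpen Ω') (hΩ'cpt : IsCompact (closure Ω'))
    (hΩ'sub : closure Ω' ⊆ {x ∈ Ω | 0 < ∑ i, (E x i) ^ 2}) :
    ∃ c > 0, ∀ w : (Fin d → ℝ) → (Fin d → ℝ),
      ContDiff ℝ (⊤ : ℕ∞) w → HasCompactSupport w → tsupport w ⊆ Ω →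
      wLuxNorm d Ω' p (fun _ => 1) (fun x => ‖w x‖) +
        wLuxNorm d Ω' p (fun _ => 1) (fun x => ‖fderiv ℝ w x‖) ≤
      c * (((∫⁻ x in Ω, ENNReal.ofReal
              (‖w x‖ ^ pminus * ∑ i, (E x i) ^ 2)).toReal) ^ (1 / pminus)
        + wLuxNorm d Ω p (fun x => ∑ i, (E x i) ^ 2)
            (fun x => ‖fderiv ℝ w x‖)) := by
  set σ : (Fin d → ℝ) → ℝ := fun x => ∑ i, (E x i) ^ 2
  have hd' : (2 : ℝ) ≤ d := by exact_mod_cast hd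
  have hpm1 : 1 ≤ pminus := by
    refine le_trans ?_ hpm
    rw [le_div_iff₀ (by linarith)]
    linarith
  have hp1 : ∀ x ∈ Ω, 1 ≤ p x := fun x hx => hpm1.trans (hbounds x hx).1
  have hσc : ContinuousOn σ Ω := by
    have := hEc.continuousOn
    fun_prop
  have hσ0 : ∀ x, 0 ≤ σ x := fun x => Finset.sum_nonneg fun i _ => sq_nonneg _
  have hσS : ∀ x ∈ Ω, σ x ≤ d * M ^ 2 := fun x hx => by
    calc σ x ≤ ∑ _i : Fin d, M ^ 2 := Finset.sum_le_sum fun i _ =>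
          sq_le_sq.2 (((norm_le_pi_norm (E x) i).trans (hEb x hx)).trans (le_abs_self M))
      _ = d * M ^ 2 := by simp
  have hS : 0 ≤ d * M ^ 2 := by positivity
  have hΩm : MeasurableSet Ω := hΩo.measurableSet
  have hΩfin : volume Ω ≠ ⊤ := hΩb.measure_lt_top.ne
  have hQΩ : closure Ω' ⊆ Ω := fun x hx => (hΩ'sub hx).1
  have hΩ'Ω : Ω' ⊆ Ω := subset_closure.trans hQΩ
  obtain ⟨δ, hδ, hσδ⟩ : ∃ δ > 0, ∀ x ∈ Ω', δ ≤ σ x := by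
    rcases (closure Ω').eq_empty_or_nonempty with he | hne
    · exact ⟨1, one_pos, fun x hx => absurd (subset_closure hx) (by simp [he])⟩
    · obtain ⟨y, hy, hmin⟩ := hΩ'cpt.exists_isMinOn hne (hσc.mono hQΩ)
      exact ⟨σ y, (hΩ'sub hy).2, fun x hx => hmin (subset_closure hx)⟩
  obtain ⟨K₀, hK₀, hloc⟩ := exists_modular_le_of_isCompact (F := Fin d → ℝ) volume
    (by simpa using hd) hΩo hΩ'cpt hQΩ hpc hσc (fun x hx => (hΩ'sub hx).2) hpm1 hp1
  set K : ℝ := 1 + K₀.toReal + δ⁻¹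
  have hK₀0 : 0 ≤ K₀.toReal := ENNReal.toReal_nonneg
  have hδ0 : 0 < δ⁻¹ := inv_pos.2 hδ
  have hK1 : 1 ≤ K := by linarith
  refine ⟨2 * K, by positivity, fun w hw hwc _ => ?_⟩
  have hw1 : ContDiff ℝ 1 w := hw.of_le (by exact_mod_cast le_top)
  obtain ⟨B₀, hB₀⟩ := hwc.exists_bound_of_continuous hw1.continuous
  obtain ⟨B₁, hB₁⟩ := (hwc.fderiv (𝕜 := ℝ)).exists_bound_of_continuous
    (hw1.continuous_fderiv one_ne_zero)
  have hB₀0 : 0 ≤ B₀ := (norm_nonneg _).trans (hB₀ 0)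
  have hIfin : ∫⁻ x in Ω, ENNReal.ofReal (‖w x‖ ^ pminus * σ x) ≠ ⊤ := by
    refine ne_top_of_le_ne_top ENNReal.ofReal_ne_top (setLIntegral_ofReal_le_mul_measureReal
      hΩm hΩfin (c := B₀ ^ pminus * (d * M ^ 2)) (by positivity) fun x hx => ?_)
    refine mul_le_mul ?_ (hσS x hx) (hσ0 x) (by positivity)
    exact Real.rpow_le_rpow (norm_nonneg _) (hB₀ x) (by linarith)
  set A : ℝ := (∫⁻ x in Ω, ENNReal.ofReal (‖w x‖ ^ pminus * σ x)).toReal ^ (1 / pminus)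
  have hA : 0 ≤ A := Real.rpow_nonneg ENNReal.toReal_nonneg _
  have hadm : ∀ lam : ℝ, 0 < lam →
      ∫⁻ x in Ω, ENNReal.ofReal ((‖fderiv ℝ w x‖ / lam) ^ p x * σ x) ≤ 1 →
      wLuxNorm d Ω' p (fun _ => 1) (fun x => ‖w x‖) +
        wLuxNorm d Ω' p (fun _ => 1) (fun x => ‖fderiv ℝ w x‖) ≤ 2 * K * (A + lam) := by
    intro lam hlam hmod
    have hΛ : 0 < A + lam := by positivity
    have hgrad : ∫⁻ x in Ω, ENNReal.ofReal ((‖fderiv ℝ w x‖ / (A + lam)) ^ p x * σ x) ≤ 1 := by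
      refine le_trans (setLIntegral_mono' hΩm fun x hx => ?_) hmod
      refine ENNReal.ofReal_le_ofReal (mul_le_mul_of_nonneg_right ?_ (hσ0 x))
      refine Real.rpow_le_rpow (by positivity) ?_ (zero_le_one.trans (hp1 x hx))
      gcongr
      linarith
    have hval : ∫⁻ x in Ω, ENNReal.ofReal ((‖w x‖ / (A + lam)) ^ pminus * σ x) ≤ 1 :=
      lintegral_div_rpow_mul_le_one (fun x => norm_nonneg _) (by linarith) hΛ hIfin
        (le_add_of_nonneg_right hlam.le)
    have hnorm : ∀ x, ‖((A + lam)⁻¹ • w) x‖ = ‖w x‖ / (A + lam) := fun x => by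
      rw [Pi.smul_apply, norm_smul, Real.norm_of_nonneg (by positivity), inv_mul_eq_div]
    have hnormd : ∀ x, ‖fderiv ℝ ((A + lam)⁻¹ • w) x‖ = ‖fderiv ℝ w x‖ / (A + lam) := fun x => by
      rw [fderiv_const_smul (hw1.differentiable one_ne_zero x), norm_smul,
        Real.norm_of_nonneg (by positivity), inv_mul_eq_div]
    have hv := hloc ((A + lam)⁻¹ • w) (hw1.const_smul (A + lam)⁻¹) (by simpa only [hnorm] using hval)
      (by simpa only [hnormd] using hgrad)
    simp only [hnorm] at hv
    have h0 : wLuxNorm d Ω' p (fun _ => 1) (fun x => ‖w x‖) ≤ K * (A + lam) := by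
      refine wLuxNorm_one_le_mul hΩ'o.measurableSet (fun x hx => hp1 x (hΩ'Ω hx))
        (fun x => norm_nonneg _) hK1 hΛ ((lintegral_mono_set subset_closure).trans (hv.trans ?_))
      exact (ENNReal.le_ofReal_iff_toReal_le hK₀ (by linarith)).2 (by linarith)
    have h1 : wLuxNorm d Ω' p (fun _ => 1) (fun x => ‖fderiv ℝ w x‖) ≤ K * (A + lam) := by
      refine wLuxNorm_one_le_mul hΩ'o.measurableSet (fun x hx => hp1 x (hΩ'Ω hx))
        (fun x => norm_nonneg _) hK1 hΛ ((setLIntegral_le_of_weight_ge hΩ'o.measurableSet hΩ'Ω hδ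
          (fun x _ => by positivity) hσδ hgrad).trans ?_)
      rw [mul_one]
      exact ENNReal.ofReal_le_ofReal (by linarith)
    linarith
  obtain ⟨lam₀, hlam₀⟩ := exists_pos_modular_div_le_one (f := fun x => ‖fderiv ℝ w x‖) hΩm hΩfin
    hp1 (fun x hx => ⟨hσ0 x, hσS x hx⟩) hS (fun x => ⟨norm_nonneg _, hB₁ x⟩)
  have hK2 : 0 < 2 * K := by positivity
  rw [← div_le_iff₀' hK2, ← sub_le_iff_le_add']
  refine le_csInf ⟨lam₀, hlam₀⟩ fun lam hlam => ?_
  rw [sub_le_iff_le_add', div_le_iff₀' hK2]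
  exact hadm lam hlam.1 hlam.2
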